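/- Let (A, φ) be a noncommutative probability space with free cumulants (κ_n)_{n≥1}. Let i(1), i(2), …, i(n) ∈ I and let b_1, b̃_1, b_2, …, b_n ∈ A be arbitrary elements. Then Σ_{π ∈ NC^ε[(i(1),i(1),i(2),…,i(n))]} κ_π(b_1, b̃_1, b_2, …, b_n) = Σ_{σ ∈ NC^ε[(i(1),i(2),…,i(n))]} κ_σ(b_1 b̃_1, b_2, …, b_n), where κ_π denotes the product of free cumulants over the blocks of π. -/

import Mathlib

open Finset

/-- A tuple of indices in `I_n^ε`: whenever two entries agree, some entry strictly
between them is different and ε-free from them. -/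
def EpsTuple {I : Type*} (ε : I → I → Bool) {n : ℕ} (idx : Fin n → I) : Prop :=
  ∀ k l : Fin n, k < l → idx k = idx l →
    ∃ p : Fin n, k < p ∧ p < l ∧ idx p ≠ idx k ∧ ε (idx k) (idx p) = false

/-- ε-independence of a family of unital subalgebras `S i` of `A` with respect to the
state `φ`: the algebras `S i` and `S j` commute whenever `ε i j = 1`, and centered
mixed moments along tuples in `I_n^ε` vanish. -/
def EpsIndep {I : Type*} {A : Type*} [Ring A] [Algebra ℂ A]
    (ε : I → I → Bool) (S : I → Subalgebra ℂ A) (φ : A →ₗ[ℂ] ℂ) : Prop :=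
  (∀ i j, ε i j = true → ∀ a ∈ S i, ∀ b ∈ S j, a * b = b * a) ∧
  ∀ (n : ℕ) (idx : Fin n → I) (a : Fin n → A),
    EpsTuple ε idx → (∀ k, a k ∈ S (idx k)) → (∀ k, φ (a k) = 0) →
    φ (List.ofFn a).prod = 0
/-- `p` and `q` lie in a common block of `P`. -/
def SameBlock {n : ℕ} (P : Finset (Finset (Fin n))) (p q : Fin n) : Prop :=
  ∃ V ∈ P, p ∈ V ∧ q ∈ V

/-- `P` is a partition of `{1,…,n}` (modelled on `Fin n`): its blocks are nonempty and
every point lies in exactly one block. -/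
def IsPartition {n : ℕ} (P : Finset (Finset (Fin n))) : Prop :=
  (∅ ∉ P) ∧ ∀ k : Fin n, ∃! V, V ∈ P ∧ k ∈ V

/-- `P ≤ ker idx`: every block of `P` is contained in a level set of `idx`. -/
def LeKer {I : Type*} {n : ℕ} (idx : Fin n → I) (P : Finset (Finset (Fin n))) : Prop :=
  ∀ p q, SameBlock P p q → idx p = idx q

/-- `P` is `(ε, idx)`-non-crossing: every crossing of two blocks happens at indices
`i, j` with `ε i j = 1`. -/
def IsEpsNC {I : Type*} (ε : I → I → Bool) {n : ℕ} (idx : Fin n → I)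
    (P : Finset (Finset (Fin n))) : Prop :=
  ∀ p₁ q₁ p₂ q₂ : Fin n, p₁ < q₁ → q₁ < p₂ → p₂ < q₂ →
    SameBlock P p₁ p₂ → SameBlock P q₁ q₂ → ¬ SameBlock P p₁ q₁ →
    ε (idx p₁) (idx q₁) = true

/-- `NC^ε[idx]`: the partitions `P ≤ ker idx` that are `(ε, idx)`-non-crossing. -/
def NCeps {I : Type*} (ε : I → I → Bool) {n : ℕ} (idx : Fin n → I) :
    Set (Finset (Finset (Fin n))) :=
  {P | IsPartition P ∧ LeKer idx P ∧ IsEpsNC ε idx P}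

/-- `P` is non-crossing. -/
def IsNonCrossing {n : ℕ} (P : Finset (Finset (Fin n))) : Prop :=
  ∀ p₁ q₁ p₂ q₂ : Fin n, p₁ < q₁ → q₁ < p₂ → p₂ < q₂ →
    SameBlock P p₁ p₂ → SameBlock P q₁ q₂ → SameBlock P p₁ q₁

/-- `NC(n)`: the set of non-crossing partitions of `{1,…,n}`. -/
def NCset (n : ℕ) : Set (Finset (Finset (Fin n))) :=
  {P | IsPartition P ∧ IsNonCrossing P}
/-- `κ_P`: the product, over the blocks `V` of `P`, of the cumulant `κ_{|V|}` applied to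
the arguments indexed by `V` in increasing order. -/
noncomputable def cumPart {A : Type*} (κ : (m : ℕ) → (Fin m → A) → ℂ)
    {n : ℕ} (P : Finset (Finset (Fin n))) (a : Fin n → A) : ℂ :=
  ∏ V ∈ P, κ V.card (fun j => a ((V.orderIsoOfFin rfl j).1))

/-- `κ` is the family of free cumulants of `(A, φ)`: it satisfies the defining
moment–cumulant formula, summing over all non-crossing partitions. -/
def IsFreeCumulants {A : Type*} [Ring A] [Algebra ℂ A] (φ : A →ₗ[ℂ] ℂ)
    (κ : (m : ℕ) → (Fin m → A) → ℂ) : Prop :=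
  ∀ (m : ℕ) (b : Fin m → A),
    φ (List.ofFn b).prod = ∑ᶠ P ∈ NCset m, cumPart κ P b

section Partitions

variable {n : ℕ} {P Q : Finset (Finset (Fin n))}

theorem IsPartition.eq_of_mem (hP : IsPartition P) {V W : Finset (Fin n)} (hV : V ∈ P)
    (hW : W ∈ P) {x : Fin n} (hxV : x ∈ V) (hxW : x ∈ W) : V = W :=
  (hP.2 x).unique ⟨hV, hxV⟩ ⟨hW, hxW⟩

theorem IsPartition.sameBlock_refl (hP : IsPartition P) (x : Fin n) : SameBlock P x x := by
  obtain ⟨V, ⟨hV, hx⟩, -⟩ := hP.2 x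
  exact ⟨V, hV, hx, hx⟩

theorem SameBlock.symm {x y : Fin n} (h : SameBlock P x y) : SameBlock P y x := by
  obtain ⟨V, hV, hx, hy⟩ := h
  exact ⟨V, hV, hy, hx⟩

theorem IsPartition.sameBlock_trans (hP : IsPartition P) {x y z : Fin n}
    (h : SameBlock P x y) (h' : SameBlock P y z) : SameBlock P x z := by
  obtain ⟨V, hV, hx, hy⟩ := h
  obtain ⟨W, hW, hy', hz⟩ := h'
  obtain rfl := hP.eq_of_mem hV hW hy hy'
  exact ⟨V, hV, hx, hz⟩

theorem IsPartition.mem_iff (hP : IsPartition P) {V : Finset (Fin n)} (hV : V ∈ P)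
    {x : Fin n} (hx : x ∈ V) (y : Fin n) : y ∈ V ↔ SameBlock P x y := by
  constructor
  · intro hy
    exact ⟨V, hV, hx, hy⟩
  · rintro ⟨W, hW, hx', hy⟩
    rwa [hP.eq_of_mem hV hW hx hx']

theorem IsPartition.subset_of_sameBlock_iff (hP : IsPartition P) (hQ : IsPartition Q)
    (h : ∀ x y, SameBlock P x y ↔ SameBlock Q x y) : P ⊆ Q := by
  intro V hV
  obtain ⟨x, hx⟩ : V.Nonempty := by
    rw [Finset.nonempty_iff_ne_empty]
    rintro rfl
    exact hP.1 hV
  obtain ⟨W, ⟨hW, hxW⟩, -⟩ := hQ.2 x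
  have : V = W := by
    ext y
    rw [hP.mem_iff hV hx, hQ.mem_iff hW hxW, h]
  rwa [this]

theorem IsPartition.ext (hP : IsPartition P) (hQ : IsPartition Q)
    (h : ∀ x y, SameBlock P x y ↔ SameBlock Q x y) : P = Q :=
  (hP.subset_of_sameBlock_iff hQ h).antisymm
    (hQ.subset_of_sameBlock_iff hP fun x y => (h x y).symm)

open Classical in
/-- The block of `P` containing `x`. -/
noncomputable def blockOf (P : Finset (Finset (Fin n))) (x : Fin n) : Finset (Fin n) :=
  univ.filter (SameBlock P x)

theorem mem_blockOf {x y : Fin n} : y ∈ blockOf P x ↔ SameBlock P x y := by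
  simp [blockOf]

theorem IsPartition.blockOf_mem (hP : IsPartition P) (x : Fin n) : blockOf P x ∈ P := by
  obtain ⟨V, ⟨hV, hx⟩, -⟩ := hP.2 x
  have : blockOf P x = V := by
    ext y
    rw [mem_blockOf, hP.mem_iff hV hx]
  rwa [this]

open Classical in
/-- The set of classes of a relation on `Fin n`. -/
noncomputable def classesOf (R : Fin n → Fin n → Prop) : Finset (Finset (Fin n)) :=
  univ.image fun x => univ.filter (R x)

theorem isPartition_classesOf {R : Fin n → Fin n → Prop} (hR : Equivalence R) :
    IsPartition (classesOf R) := by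
  classical
  refine ⟨?_, fun x => ⟨univ.filter (R x), ⟨?_, ?_⟩, ?_⟩⟩
  · intro h
    obtain ⟨x, -, hx⟩ := Finset.mem_image.1 h
    have : x ∈ univ.filter (R x) := by simpa using hR.refl x
    rw [hx] at this
    simp at this
  · exact Finset.mem_image.2 ⟨x, mem_univ _, rfl⟩
  · simpa using hR.refl x
  · rintro V ⟨hV, hx⟩
    obtain ⟨y, -, rfl⟩ := Finset.mem_image.1 hV
    have hyx : R y x := by simpa using hx
    ext z
    simp only [mem_filter, mem_univ, true_and]
    exact ⟨fun h => hR.trans (hR.symm hyx) h, fun h => hR.trans hyx h⟩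

theorem sameBlock_classesOf {R : Fin n → Fin n → Prop} (hR : Equivalence R) (x y : Fin n) :
    SameBlock (classesOf R) x y ↔ R x y := by
  classical
  constructor
  · rintro ⟨V, hV, hx, hy⟩
    obtain ⟨z, -, rfl⟩ := Finset.mem_image.1 hV
    simp only [mem_filter, mem_univ, true_and] at hx hy
    exact hR.trans (hR.symm hx) hy
  · intro h
    exact ⟨univ.filter (R x), Finset.mem_image.2 ⟨x, mem_univ _, rfl⟩, by simpa using hR.refl x,
      by simpa using h⟩

end Partitions

section BlockCumulant

variable {A : Type*} (κ : (m : ℕ) → (Fin m → A) → ℂ)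

/-- The cumulant of the arguments indexed by `V`, in increasing order, with value `1` on the
empty set. -/
noncomputable def blockCum {n : ℕ} (V : Finset (Fin n)) (a : Fin n → A) : ℂ :=
  if V = ∅ then 1 else κ V.card (fun j => a ((V.orderIsoOfFin rfl j).1))

theorem blockCum_empty {n : ℕ} (a : Fin n → A) : blockCum κ ∅ a = 1 := by
  simp [blockCum]

theorem cumPart_eq_prod_blockCum {n : ℕ} {P : Finset (Finset (Fin n))} (hP : IsPartition P)
    (a : Fin n → A) : cumPart κ P a = ∏ V ∈ P, blockCum κ V a := by
  refine Finset.prod_congr rfl fun V hV => ?_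
  rw [blockCum, if_neg]
  rintro rfl
  exact hP.1 hV

theorem blockCum_congr {n : ℕ} {V : Finset (Fin n)} {a a' : Fin n → A}
    (h : ∀ x ∈ V, a x = a' x) : blockCum κ V a = blockCum κ V a' := by
  have : (fun j => a ((V.orderIsoOfFin rfl j).1)) = fun j => a' ((V.orderIsoOfFin rfl j).1) :=
    funext fun j => h _ (V.orderIsoOfFin rfl j).2
  rw [blockCum, blockCum, this]

theorem cumulant_eq_of_orderEmbedding {n m : ℕ} {V : Finset (Fin n)} (e : Fin m ↪o Fin n)
    (he : ∀ x, e x ∈ V) (h : V.card = m) (a : Fin n → A) :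
    κ V.card (fun j => a ((V.orderIsoOfFin rfl j).1)) = κ m (a ∘ e) := by
  subst h
  have : e = V.orderEmbOfFin rfl := Finset.orderEmbOfFin_unique' rfl he
  rw [this]
  rfl

theorem blockCum_map {m n : ℕ} (f : Fin m ↪o Fin n) (V : Finset (Fin m)) (a : Fin n → A) :
    blockCum κ (V.map f.toEmbedding) a = blockCum κ V (a ∘ f) := by
  rw [blockCum, blockCum]
  by_cases hV : V = ∅
  · simp [hV]
  · rw [if_neg hV, if_neg (by simpa using hV)]
    exact cumulant_eq_of_orderEmbedding κ ((V.orderEmbOfFin rfl).trans f) (by simp) (by simp) a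

end BlockCumulant

section Doubling

/-- The monotone surjection identifying the points `0` and `1`. -/
def mergeZeroOne {n : ℕ} : Fin (n + 2) → Fin (n + 1) := Fin.cons 0 id

@[simp] theorem mergeZeroOne_zero {n : ℕ} : mergeZeroOne (0 : Fin (n + 2)) = 0 := rfl

@[simp] theorem mergeZeroOne_succ {n : ℕ} (x : Fin (n + 1)) : mergeZeroOne x.succ = x := rfl

@[simp] theorem mergeZeroOne_one {n : ℕ} : mergeZeroOne (1 : Fin (n + 2)) = 0 := rfl

theorem mergeZeroOne_mono {n : ℕ} : Monotone (mergeZeroOne (n := n)) := by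
  intro x y h
  induction x using Fin.cases with
  | zero => simp
  | succ x =>
    induction y using Fin.cases with
    | zero => simp at h
    | succ y => simpa using h

theorem cons_zero_eq_comp_mergeZeroOne {α : Type*} {n : ℕ} (idx : Fin (n + 1) → α) :
    (Fin.cons (idx 0) idx : Fin (n + 2) → α) = idx ∘ mergeZeroOne := by
  funext x
  induction x using Fin.cases <;> simp

/-- The preimage of a set under `mergeZeroOne`. -/
def doublePre {n : ℕ} (W : Finset (Fin (n + 1))) : Finset (Fin (n + 2)) :=
  univ.filter fun z => mergeZeroOne z ∈ W

theorem mem_doublePre {n : ℕ} {W : Finset (Fin (n + 1))} {z : Fin (n + 2)} :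
    z ∈ doublePre W ↔ mergeZeroOne z ∈ W := by
  simp [doublePre]

open Classical in
/-- The sets by which a set `U` containing `0` and `1` can be cut without crossing into the
part of `1` and the part of `0`, with `∅` standing for no cut. -/
noncomputable def cuts {n : ℕ} (U : Finset (Fin (n + 2))) : Finset (Finset (Fin (n + 2))) :=
  U.powerset.filter fun T =>
    T = ∅ ∨ (0 ∉ T ∧ 1 ∈ T ∧ ∀ x ∈ T, ∀ y ∈ U, y ∉ T → y ≠ 0 → x < y)

theorem mem_cuts {n : ℕ} {U T : Finset (Fin (n + 2))} :
    T ∈ cuts U ↔ T ⊆ U ∧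
      (T = ∅ ∨ (0 ∉ T ∧ 1 ∈ T ∧ ∀ x ∈ T, ∀ y ∈ U, y ∉ T → y ≠ 0 → x < y)) := by
  simp [cuts]

/-- The sum over all cuts of `U` of the products of the cumulants of the two parts. -/
noncomputable def cutSum {A : Type*} (κ : (m : ℕ) → (Fin m → A) → ℂ) {n : ℕ}
    (U : Finset (Fin (n + 2))) (a : Fin (n + 2) → A) : ℂ :=
  ∑ T ∈ cuts U, blockCum κ (U ∩ T) a * blockCum κ (U \ T) a

theorem cutSum_map {A : Type*} (κ : (m : ℕ) → (Fin m → A) → ℂ) {m n : ℕ}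
    (f : Fin (m + 2) ↪o Fin (n + 2)) (h0 : f 0 = 0) (h1 : f 1 = 1)
    (U : Finset (Fin (m + 2))) (a : Fin (n + 2) → A) :
    cutSum κ (U.map f.toEmbedding) a = cutSum κ U (a ∘ f) := by
  symm
  have hf : ∀ x y, f x = f y ↔ x = y := fun x y => f.injective.eq_iff
  have mem_map' : ∀ (S : Finset (Fin (m + 2))) x, f x ∈ S.map f.toEmbedding ↔ x ∈ S :=
    fun S x => Finset.mem_map' f.toEmbedding
  have key : ∀ T : Finset (Fin (m + 2)),
      T.map f.toEmbedding ∈ cuts (U.map f.toEmbedding) ↔ T ∈ cuts U := by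
    intro T
    rw [mem_cuts, mem_cuts, Finset.map_subset_map, Finset.map_eq_empty]
    have e0 : (0 : Fin (n + 2)) ∈ T.map f.toEmbedding ↔ 0 ∈ T := by
      rw [← mem_map' T 0, h0]
    have e1 : (1 : Fin (n + 2)) ∈ T.map f.toEmbedding ↔ 1 ∈ T := by
      rw [← mem_map' T 1, h1]
    have hne : ∀ y, f y ≠ 0 ↔ y ≠ 0 := by
      intro y
      rw [← h0, Ne, hf]
    rw [e0, e1]
    simp only [Finset.forall_mem_map, RelEmbedding.coe_toEmbedding, mem_map', hne,
      OrderEmbedding.lt_iff_lt]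
  refine Finset.sum_bij (fun T _ => T.map f.toEmbedding) (fun T hT => (key T).2 hT)
    (fun T _ T' _ h => Finset.map_injective _ h) ?_ ?_
  · intro T hT
    obtain ⟨T', -, rfl⟩ := Finset.subset_map_iff.1 (mem_cuts.1 hT).1
    exact ⟨T', (key T').1 hT, rfl⟩
  · intro T _
    rw [← Finset.map_inter, ← Finset.map_sdiff, blockCum_map, blockCum_map]

/-- The partition obtained from `σ` by doubling the point `0` and cutting by `T`. -/
def doubleCut {n : ℕ} (σ : Finset (Finset (Fin (n + 1)))) (T : Finset (Fin (n + 2))) :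
    Finset (Finset (Fin (n + 2))) :=
  σ.biUnion fun W => ({doublePre W ∩ T, doublePre W \ T} : Finset _).erase ∅

variable {n : ℕ} {σ : Finset (Finset (Fin (n + 1)))}

theorem sameBlock_doubleCut (T : Finset (Fin (n + 2))) (p q : Fin (n + 2)) :
    SameBlock (doubleCut σ T) p q ↔
      SameBlock σ (mergeZeroOne p) (mergeZeroOne q) ∧ (p ∈ T ↔ q ∈ T) := by
  constructor
  · rintro ⟨V, hV, hp, hq⟩
    simp only [doubleCut, mem_biUnion, mem_erase, mem_insert, mem_singleton] at hV
    obtain ⟨W, hW, -, rfl | rfl⟩ := hV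
    · simp only [mem_inter, mem_doublePre] at hp hq
      exact ⟨⟨W, hW, hp.1, hq.1⟩, by simp [hp.2, hq.2]⟩
    · simp only [mem_sdiff, mem_doublePre] at hp hq
      exact ⟨⟨W, hW, hp.1, hq.1⟩, by simp [hp.2, hq.2]⟩
  · rintro ⟨⟨W, hW, hp, hq⟩, h⟩
    by_cases hT : p ∈ T
    · have hp' : p ∈ doublePre W ∩ T := by simp [mem_doublePre, hp, hT]
      refine ⟨doublePre W ∩ T, ?_, hp', by simp [mem_doublePre, hq, ← h, hT]⟩
      simp only [doubleCut, mem_biUnion, mem_erase, mem_insert, mem_singleton]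
      exact ⟨W, hW, Finset.ne_empty_of_mem hp', Or.inl rfl⟩
    · have hp' : p ∈ doublePre W \ T := by simp [mem_doublePre, hp, hT]
      refine ⟨doublePre W \ T, ?_, hp', by simp [mem_doublePre, hq, ← h, hT]⟩
      simp only [doubleCut, mem_biUnion, mem_erase, mem_insert, mem_singleton]
      exact ⟨W, hW, Finset.ne_empty_of_mem hp', Or.inr rfl⟩

theorem isPartition_doubleCut (hσ : IsPartition σ) (T : Finset (Fin (n + 2))) :
    IsPartition (doubleCut σ T) := by
  refine ⟨by simp [doubleCut], fun x => ?_⟩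
  obtain ⟨V, hV, hx, -⟩ :=
    (sameBlock_doubleCut (σ := σ) T x x).2 ⟨hσ.sameBlock_refl _, Iff.rfl⟩
  refine ⟨V, ⟨hV, hx⟩, ?_⟩
  rintro V' ⟨hV', hx'⟩
  simp only [doubleCut, mem_biUnion, mem_erase, mem_insert, mem_singleton] at hV hV'
  obtain ⟨W, hW, -, h⟩ := hV
  obtain ⟨W', hW', -, h'⟩ := hV'
  have hxW : mergeZeroOne x ∈ W := by
    rcases h with rfl | rfl
    · exact mem_doublePre.1 (mem_inter.1 hx).1
    · exact mem_doublePre.1 (mem_sdiff.1 hx).1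
  have hxW' : mergeZeroOne x ∈ W' := by
    rcases h' with rfl | rfl
    · exact mem_doublePre.1 (mem_inter.1 hx').1
    · exact mem_doublePre.1 (mem_sdiff.1 hx').1
  obtain rfl := hσ.eq_of_mem hW hW' hxW hxW'
  rcases h with rfl | rfl <;> rcases h' with rfl | rfl <;> simp_all

theorem prod_doubleCut (hσ : IsPartition σ) (T : Finset (Fin (n + 2)))
    {g : Finset (Fin (n + 2)) → ℂ} (hg : g ∅ = 1) :
    ∏ V ∈ doubleCut σ T, g V =
      ∏ W ∈ σ, (g (doublePre W ∩ T) * g (doublePre W \ T)) := by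
  rw [doubleCut, Finset.prod_biUnion]
  · refine Finset.prod_congr rfl fun W _ => ?_
    rw [Finset.prod_erase _ hg]
    by_cases h : doublePre W ∩ T = doublePre W \ T
    · have h0 : doublePre W ∩ T = ∅ := by
        ext x
        have := Finset.ext_iff.1 h x
        simp only [mem_inter, mem_sdiff] at this
        simp only [mem_inter, notMem_empty, iff_false]
        tauto
      rw [← h, h0]
      simp [hg]
    · rw [Finset.prod_pair h]
  · intro W hW W' hW' hne
    rw [Function.onFun, Finset.disjoint_left]
    intro V hV hV'
    simp only [mem_erase, mem_insert, mem_singleton] at hV hV'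
    obtain ⟨x, hx⟩ := Finset.nonempty_iff_ne_empty.2 hV.1
    refine hne (hσ.eq_of_mem hW hW' (x := mergeZeroOne x) ?_ ?_)
    · rcases hV.2 with rfl | rfl
      · exact mem_doublePre.1 (mem_inter.1 hx).1
      · exact mem_doublePre.1 (mem_sdiff.1 hx).1
    · rcases hV'.2 with rfl | rfl
      · exact mem_doublePre.1 (mem_inter.1 hx).1
      · exact mem_doublePre.1 (mem_sdiff.1 hx).1

variable {I : Type*} {ε : I → I → Bool} {idx : Fin (n + 1) → I}

theorem doubleCut_mem_NCeps (hσ : σ ∈ NCeps ε idx) {T : Finset (Fin (n + 2))}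
    (hT : T ∈ cuts (doublePre (blockOf σ 0))) :
    doubleCut σ T ∈ NCeps ε (idx ∘ mergeZeroOne) := by
  obtain ⟨hpart, hker, hnc⟩ := hσ
  obtain ⟨hTU, hT⟩ := mem_cuts.1 hT
  have hU : ∀ {x}, x ∈ doublePre (blockOf σ 0) ↔ SameBlock σ 0 (mergeZeroOne x) := by
    intro x
    rw [mem_doublePre, mem_blockOf]
  refine ⟨isPartition_doubleCut hpart T, ?_, ?_⟩
  · intro p q h
    exact hker _ _ ((sameBlock_doubleCut T p q).1 h).1
  · intro p₁ q₁ p₂ q₂ h₁ h₂ h₃ hp hq hpq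
    rw [sameBlock_doubleCut] at hp hq hpq
    by_cases h : SameBlock σ (mergeZeroOne p₁) (mergeZeroOne q₁)
    · exfalso
      by_cases hpT : p₁ ∈ T
      · have hqT : q₁ ∉ T := fun hqT => hpq ⟨h, by simp [hpT, hqT]⟩
        rcases hT with rfl | ⟨-, -, hT⟩
        · simp at hpT
        · have := hT p₂ (hp.2.1 hpT) q₁
            (hU.2 (hpart.sameBlock_trans (hU.1 (hTU hpT)) h)) hqT (Fin.ne_zero_of_lt h₁)
          exact absurd this h₂.le.not_gt
      · have hqT : q₁ ∈ T := by
          by_contra hqT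
          exact hpq ⟨h, by simp [hpT, hqT]⟩
        rcases hT with rfl | ⟨-, -, hT⟩
        · simp at hqT
        · have := hT q₂ (hq.2.1 hqT) p₂
            (hU.2 (hpart.sameBlock_trans (hpart.sameBlock_trans (hU.1 (hTU hqT)) h.symm) hp.1))
            (fun h' => hpT (hp.2.2 h')) (Fin.ne_zero_of_lt h₂)
          exact absurd this h₃.le.not_gt
    · refine hnc _ _ _ _ ((mergeZeroOne_mono h₁.le).lt_of_ne ?_)
        ((mergeZeroOne_mono h₂.le).lt_of_ne ?_) ((mergeZeroOne_mono h₃.le).lt_of_ne ?_)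
        hp.1 hq.1 h
      · intro e
        exact h (e ▸ hpart.sameBlock_refl _)
      · intro e
        exact h (e ▸ hp.1)
      · intro e
        exact h (hpart.sameBlock_trans hp.1 (e ▸ hq.1.symm))

theorem sameBlock_doubleCut_zero_or_one {T : Finset (Fin (n + 2))}
    (hT : T ∈ cuts (doublePre (blockOf σ 0))) (z : Fin (n + 2)) :
    SameBlock (doubleCut σ T) 0 z ∨ SameBlock (doubleCut σ T) 1 z ↔
      SameBlock σ 0 (mergeZeroOne z) := by
  obtain ⟨-, hT⟩ := mem_cuts.1 hT
  simp only [sameBlock_doubleCut, mergeZeroOne_zero, mergeZeroOne_one]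
  rcases hT with rfl | ⟨h0, h1, -⟩
  · simp
  · simp only [h0, h1]
    tauto

theorem mem_cut_iff {T : Finset (Fin (n + 2))} (hσ : IsPartition σ)
    (hT : T ∈ cuts (doublePre (blockOf σ 0))) (z : Fin (n + 2)) :
    z ∈ T ↔ SameBlock (doubleCut σ T) 1 z ∧ ¬ SameBlock (doubleCut σ T) 0 1 := by
  obtain ⟨hTU, hT⟩ := mem_cuts.1 hT
  simp only [sameBlock_doubleCut, mergeZeroOne_zero, mergeZeroOne_one]
  have := hσ.sameBlock_refl 0
  rcases hT with rfl | ⟨h0, h1, -⟩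
  · simp [this]
  · have hz : z ∈ T → SameBlock σ 0 (mergeZeroOne z) := fun h =>
      mem_blockOf.1 (mem_doublePre.1 (hTU h))
    simp only [h0, h1]
    tauto

theorem doubleCut_injective {σ' : Finset (Finset (Fin (n + 1)))} {T T' : Finset (Fin (n + 2))}
    (hσ : IsPartition σ) (hσ' : IsPartition σ')
    (hT : T ∈ cuts (doublePre (blockOf σ 0))) (hT' : T' ∈ cuts (doublePre (blockOf σ' 0)))
    (h : doubleCut σ T = doubleCut σ' T') : σ = σ' ∧ T = T' := by
  have hTT : T = T' := by
    ext z
    rw [mem_cut_iff hσ hT, mem_cut_iff hσ' hT', h]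
  refine ⟨hσ.ext hσ' ?_, hTT⟩
  have hq : ∀ z, SameBlock σ 0 z ↔ SameBlock σ' 0 z := by
    intro z
    have h₁ := sameBlock_doubleCut_zero_or_one hT z.succ
    have h₂ := sameBlock_doubleCut_zero_or_one hT' z.succ
    rw [mergeZeroOne_succ] at h₁ h₂
    rw [← h₁, ← h₂, h]
  have hs : ∀ x y, ¬ SameBlock σ 0 x → ¬ SameBlock σ 0 y →
      (SameBlock σ x y ↔ SameBlock σ' x y) := by
    intro x y hx hy
    have e : ∀ {z}, ¬ SameBlock σ 0 z → z.succ ∉ T := by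
      intro z hz hzT
      exact hz (mem_blockOf.1 (mem_doublePre.1 ((mem_cuts.1 hT).1 hzT)))
    have h₁ := sameBlock_doubleCut (σ := σ) T x.succ y.succ
    have h₂ := sameBlock_doubleCut (σ := σ') T x.succ y.succ
    rw [h, ← hTT, h₂] at h₁
    simpa [e hx, e hy] using h₁.symm
  intro x y
  by_cases hx : SameBlock σ 0 x
  · have hx' := (hq x).1 hx
    exact ⟨fun h => hσ'.sameBlock_trans hx'.symm ((hq y).1 (hσ.sameBlock_trans hx h)),
      fun h => hσ.sameBlock_trans hx.symm ((hq y).2 (hσ'.sameBlock_trans hx' h))⟩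
  · by_cases hy : SameBlock σ 0 y
    · have hy' := (hq y).1 hy
      exact ⟨fun h => absurd (hσ.sameBlock_trans hy h.symm) hx,
        fun h => absurd ((hq x).2 (hσ'.sameBlock_trans hy' h.symm)) hx⟩
    · exact hs x y hx hy

theorem exists_doubleCut_eq (hsym : ∀ i j, ε i j = ε j i) (hdiag : ∀ i, ε i i = false)
    {P : Finset (Finset (Fin (n + 2)))} (hP : P ∈ NCeps ε (idx ∘ mergeZeroOne)) :
    ∃ σ ∈ NCeps ε idx, ∃ T ∈ cuts (doublePre (blockOf σ 0)), doubleCut σ T = P := by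
  classical
  obtain ⟨hpart, hker, hnc⟩ := hP
  have refl := hpart.sameBlock_refl
  have trans : ∀ {x y z}, SameBlock P x y → SameBlock P y z → SameBlock P x z :=
    fun h h' => hpart.sameBlock_trans h h'
  obtain ⟨q, hq⟩ : ∃ q : Fin (n + 2) → Prop, q = fun z => SameBlock P 0 z ∨ SameBlock P 1 z :=
    ⟨_, rfl⟩
  have hqz : ∀ z, q z ↔ SameBlock P 0 z ∨ SameBlock P 1 z := fun z => by rw [hq]
  have hqt : ∀ {x y}, q x → SameBlock P x y → q y := by
    intro x y hx h
    rw [hqz] at hx ⊢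
    exact hx.imp (fun h' => trans h' h) (fun h' => trans h' h)
  have hq0 : q 0 := (hqz 0).2 (Or.inl (refl 0))
  have hq1 : q 1 := (hqz 1).2 (Or.inr (refl 1))
  obtain ⟨R, hR⟩ : ∃ R : Fin (n + 1) → Fin (n + 1) → Prop,
      R = fun x y => SameBlock P x.succ y.succ ∨ (q x.succ ∧ q y.succ) := ⟨_, rfl⟩
  have hRxy : ∀ x y, R x y ↔ SameBlock P x.succ y.succ ∨ (q x.succ ∧ q y.succ) :=
    fun x y => by rw [hR]
  have hReq : Equivalence R := by
    refine ⟨fun x => (hRxy _ _).2 (Or.inl (refl _)), ?_, ?_⟩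
    · intro x y h
      rw [hRxy] at h ⊢
      exact h.imp SameBlock.symm And.symm
    · intro x y z h h'
      rw [hRxy] at h h' ⊢
      rcases h with h | h <;> rcases h' with h' | h'
      · exact Or.inl (trans h h')
      · exact Or.inr ⟨hqt h'.1 h.symm, h'.2⟩
      · exact Or.inr ⟨h.1, hqt h.2 h'⟩
      · exact Or.inr ⟨h.1, h'.2⟩
  have hRm : ∀ x y, R (mergeZeroOne x) (mergeZeroOne y) ↔ SameBlock P x y ∨ (q x ∧ q y) := by
    intro x y
    induction x using Fin.cases with
    | zero =>
      induction y using Fin.cases with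
      | zero => simp [hReq.refl, refl]
      | succ y =>
        have : (0 : Fin (n + 1)).succ = 1 := rfl
        rw [mergeZeroOne_zero, mergeZeroOne_succ, hRxy, this]
        simp only [hq0, hq1, true_and]
        exact ⟨fun h => h.elim (fun h => Or.inr (hqt hq1 h)) Or.inr,
          fun h => h.elim (fun h => Or.inr (hqt hq0 h)) Or.inr⟩
    | succ x =>
      induction y using Fin.cases with
      | zero =>
        have : (0 : Fin (n + 1)).succ = 1 := rfl
        rw [mergeZeroOne_zero, mergeZeroOne_succ, hRxy, this]
        simp only [hq0, hq1, and_true]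
        exact ⟨fun h => h.elim (fun h => Or.inr (hqt hq1 h.symm)) Or.inr,
          fun h => h.elim (fun h => Or.inr (hqt hq0 h.symm)) Or.inr⟩
      | succ y => rw [mergeZeroOne_succ, mergeZeroOne_succ, hRxy]
  have hidx : ∀ x : Fin (n + 1), q x.succ → idx x = idx 0 := by
    intro x hx
    rcases (hqz _).1 hx with h | h
    · exact (hker _ _ h).symm
    · exact (hker _ _ h).symm
  have hS := sameBlock_classesOf hReq
  refine ⟨classesOf R, ⟨isPartition_classesOf hReq, ?_, ?_⟩, ?_⟩
  · intro x y h
    rw [hS, hRxy] at h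
    rcases h with h | h
    · exact hker _ _ h
    · rw [hidx x h.1, hidx y h.2]
  · intro x₁ y₁ x₂ y₂ h₁ h₂ h₃ hx hy hxy
    rw [hS, hRxy] at hx hy hxy
    push Not at hxy
    have s₁ := Fin.succ_lt_succ_iff.2 h₁
    have s₂ := Fin.succ_lt_succ_iff.2 h₂
    have s₃ := Fin.succ_lt_succ_iff.2 h₃
    have one_le : ∀ x : Fin (n + 1), (1 : Fin (n + 2)) ≤ x.succ := by
      intro x
      have : (0 : Fin (n + 1)).succ ≤ x.succ := Fin.succ_le_succ_iff.2 (Fin.zero_le x)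
      exact this
    rcases hy with hy | hy
    · rcases hx with hx | hx
      · exact hnc _ _ _ _ s₁ s₂ s₃ hx hy hxy.1
      · have hny := hxy.2 hx.1
        rw [hidx x₁ hx.1]
        rcases (hqz _).1 hx.2 with h | h
        · exact hnc 0 _ _ _ (Fin.succ_pos _) s₂ s₃ h hy fun h' => hny ((hqz _).2 (Or.inl h'))
        · exact hnc 1 _ _ _ ((one_le _).trans_lt s₁) s₂ s₃ h hy
            fun h' => hny ((hqz _).2 (Or.inr h'))
    · have hnx : ¬ q x₁.succ := fun h => hxy.2 h hy.1
      have hx : SameBlock P x₁.succ x₂.succ := hx.resolve_right fun h => hnx h.1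
      rw [hidx y₁ hy.1, hsym]
      rcases (hqz _).1 hy.1 with h | h
      · exact hnc 0 _ _ _ (Fin.succ_pos _) s₁ s₂ h hx fun h' => hnx ((hqz _).2 (Or.inl h'))
      · refine hnc 1 _ _ _ ((one_le _).lt_of_ne ?_) s₁ s₂ h hx
          fun h' => hnx ((hqz _).2 (Or.inr h'))
        intro e
        exact hnx (e ▸ hq1)
  have hU : ∀ x, x ∈ doublePre (blockOf (classesOf R) 0) ↔ q x := by
    intro x
    rw [mem_doublePre, mem_blockOf, hS]
    have := hRm 0 x
    rw [mergeZeroOne_zero] at this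
    rw [this]
    exact ⟨fun h => h.elim (hqt hq0) And.right, fun h => Or.inr ⟨hq0, h⟩⟩
  by_cases h01 : SameBlock P 0 1
  · refine ⟨∅, mem_cuts.2 ⟨by simp, Or.inl rfl⟩, ?_⟩
    refine (isPartition_doubleCut (isPartition_classesOf hReq) _).ext hpart ?_
    intro x y
    rw [sameBlock_doubleCut, hS, hRm]
    have : ∀ z, q z → SameBlock P 0 z := fun z hz =>
      ((hqz z).1 hz).elim id (fun h => trans h01 h)
    simp only [notMem_empty, and_true]
    exact ⟨fun h => h.elim id fun h => trans (this _ h.1).symm (this _ h.2), Or.inl⟩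
  · refine ⟨blockOf P 1, mem_cuts.2 ⟨?_, Or.inr ⟨?_, ?_, ?_⟩⟩, ?_⟩
    · intro x hx
      rw [hU, hqz]
      exact Or.inr (mem_blockOf.1 hx)
    · rw [mem_blockOf]
      exact fun h => h01 h.symm
    · exact mem_blockOf.2 (refl 1)
    · intro x hx y hy hyT hy0
      rw [mem_blockOf] at hx hyT
      rw [hU, hqz] at hy
      have hy := hy.resolve_right hyT
      by_contra hlt
      have hyx : y < x := by
        refine (not_lt.1 hlt).lt_of_ne ?_
        rintro rfl
        exact hyT hx
      have h1y : (1 : Fin (n + 2)) < y := by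
        refine lt_of_le_of_ne ?_ ?_
        · rw [Fin.le_def]
          exact Nat.one_le_iff_ne_zero.2 fun h => hy0 (Fin.ext h)
        · rintro rfl
          exact hyT (refl 1)
      have := hnc 0 1 y x Fin.zero_lt_one h1y hyx hy hx h01
      simp [hdiag] at this
    · refine (isPartition_doubleCut (isPartition_classesOf hReq) _).ext hpart ?_
      intro x y
      rw [sameBlock_doubleCut, hS, hRm, mem_blockOf, mem_blockOf]
      constructor
      · rintro ⟨h | ⟨hx, hy⟩, h'⟩
        · exact h
        · rw [hqz] at hx hy
          by_cases hx1 : SameBlock P 1 x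
          · exact trans hx1.symm (h'.1 hx1)
          · exact trans (hx.resolve_right hx1).symm
              (hy.resolve_right fun h => hx1 (h'.2 h))
      · intro h
        exact ⟨Or.inl h, fun h' => trans h' h, fun h' => trans h' h.symm⟩

end Doubling

section Cumulants

variable {A : Type*} (κ : (m : ℕ) → (Fin m → A) → ℂ) {n : ℕ}

theorem doublePre_eq_map {W : Finset (Fin (n + 1))} (h0 : 0 ∉ W) :
    doublePre W = W.map (Fin.succOrderEmb (n + 1)).toEmbedding := by
  ext x
  rw [mem_doublePre]
  induction x using Fin.cases with
  | zero => simp [h0, Fin.succ_ne_zero]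
  | succ x => simp

theorem finsum_NCeps_double {I : Type*} [Ring A] {ε : I → I → Bool}
    (hsym : ∀ i j, ε i j = ε j i)
    (hdiag : ∀ i, ε i i = false) (idx : Fin (n + 1) → I) (b : Fin (n + 1) → A) (c : A) :
    (∑ᶠ P ∈ NCeps ε (Fin.cons (idx 0) idx : Fin (n + 2) → I),
        cumPart κ P (Fin.cons (b 0) (Fin.cons c (Fin.tail b)))) =
    ∑ᶠ σ ∈ NCeps ε idx,
      (cutSum κ (doublePre (blockOf σ 0)) (Fin.cons (b 0) (Fin.cons c (Fin.tail b))) *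
        ∏ W ∈ σ.erase (blockOf σ 0), blockCum κ W (Fin.cons (b 0 * c) (Fin.tail b))) := by
  classical
  rw [cons_zero_eq_comp_mergeZeroOne, finsum_mem_eq_toFinset_sum, finsum_mem_eq_toFinset_sum]
  set a : Fin (n + 2) → A := Fin.cons (b 0) (Fin.cons c (Fin.tail b)) with ha
  simp only [cutSum, Finset.sum_mul]
  rw [Finset.sum_sigma']
  symm
  refine Finset.sum_bij (fun x _ => doubleCut x.1 x.2) ?_ ?_ ?_ ?_
  · rintro ⟨σ, T⟩ h
    rw [mem_sigma, Set.mem_toFinset] at h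
    exact Set.mem_toFinset.2 (doubleCut_mem_NCeps h.1 h.2)
  · rintro ⟨σ, T⟩ h ⟨σ', T'⟩ h' e
    rw [mem_sigma, Set.mem_toFinset] at h h'
    obtain ⟨rfl, rfl⟩ := doubleCut_injective h.1.1 h'.1.1 h.2 h'.2 e
    rfl
  · intro P hP
    obtain ⟨σ, hσ, T, hT, h⟩ := exists_doubleCut_eq hsym hdiag (Set.mem_toFinset.1 hP)
    exact ⟨⟨σ, T⟩, mem_sigma.2 ⟨Set.mem_toFinset.2 hσ, hT⟩, h⟩
  · rintro ⟨σ, T⟩ h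
    rw [mem_sigma, Set.mem_toFinset] at h
    obtain ⟨hσ, hT⟩ := h
    have hpart : IsPartition σ := hσ.1
    have h0 : (0 : Fin (n + 1)) ∈ blockOf σ 0 := mem_blockOf.2 (hpart.sameBlock_refl 0)
    rw [cumPart_eq_prod_blockCum κ (isPartition_doubleCut hpart T),
      prod_doubleCut hpart T (g := fun V => blockCum κ V a) (blockCum_empty κ a),
      ← Finset.mul_prod_erase σ _ (hpart.blockOf_mem 0)]
    congr 1
    refine Finset.prod_congr rfl fun W hW => ?_
    rw [mem_erase] at hW
    have h0W : 0 ∉ W := fun h => hW.1 (hpart.eq_of_mem hW.2 (hpart.blockOf_mem 0) h h0)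
    have hWT : ∀ x ∈ doublePre W, x ∉ T := by
      intro x hx hxT
      exact hW.1 (hpart.eq_of_mem hW.2 (hpart.blockOf_mem 0) (mem_doublePre.1 hx)
        (mem_doublePre.1 ((mem_cuts.1 hT).1 hxT)))
    have e₁ : doublePre W ∩ T = ∅ := disjoint_iff_inter_eq_empty.1 (disjoint_left.2 hWT)
    have e₂ : doublePre W \ T = doublePre W := sdiff_eq_self_of_disjoint (disjoint_left.2 hWT)
    simp only [e₁, e₂, blockCum_empty, one_mul]
    rw [doublePre_eq_map h0W, blockCum_map]
    refine blockCum_congr κ fun x hx => ?_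
    obtain ⟨y, rfl⟩ := Fin.exists_succ_eq.2 (fun h : x = 0 => h0W (h ▸ hx))
    simp [ha]

theorem finsum_NCeps_mul {I : Type*} {ε : I → I → Bool} (idx : Fin (n + 1) → I)
    (a : Fin (n + 1) → A) :
    (∑ᶠ σ ∈ NCeps ε idx, cumPart κ σ a) = ∑ᶠ σ ∈ NCeps ε idx,
      (blockCum κ (blockOf σ 0) a * ∏ W ∈ σ.erase (blockOf σ 0), blockCum κ W a) := by
  refine finsum_mem_congr rfl fun σ hσ => ?_
  rw [cumPart_eq_prod_blockCum κ hσ.1,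
    Finset.mul_prod_erase σ (fun W => blockCum κ W a) (hσ.1.blockOf_mem 0)]

/-- The order embedding extending `f` by a new smallest element on both sides. -/
def consOrderEmb {m n : ℕ} (f : Fin m ↪o Fin n) : Fin (m + 1) ↪o Fin (n + 1) :=
  OrderEmbedding.ofStrictMono (Fin.cons 0 (fun x => (f x).succ)) (by
    intro x y h
    induction x using Fin.cases with
    | zero =>
      induction y using Fin.cases with
      | zero => simp at h
      | succ y => simp
    | succ x =>
      induction y using Fin.cases with
      | zero => simp at h
      | succ y => simpa using h)

@[simp] theorem consOrderEmb_zero {m n : ℕ} (f : Fin m ↪o Fin n) : consOrderEmb f 0 = 0 := rfl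

@[simp] theorem consOrderEmb_succ {m n : ℕ} (f : Fin m ↪o Fin n) (x : Fin m) :
    consOrderEmb f x.succ = (f x).succ := rfl

/-- If the one-step product formula holds for the full set of `m + 1` points, then it holds for
every set of `m + 1` points containing `0`. -/
theorem cutSum_doublePre_of_card [Ring A] {m : ℕ}
    (h : ∀ (b : Fin (m + 1) → A) (c : A),
      cutSum κ (univ : Finset (Fin (m + 2))) (Fin.cons (b 0) (Fin.cons c (Fin.tail b))) =
        blockCum κ univ (Fin.cons (b 0 * c) (Fin.tail b) : Fin (m + 1) → A))
    {V : Finset (Fin (n + 1))} (h0 : 0 ∈ V) (hV : V.card = m + 1)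
    (b : Fin (n + 1) → A) (c : A) :
    cutSum κ (doublePre V) (Fin.cons (b 0) (Fin.cons c (Fin.tail b))) =
      blockCum κ V (Fin.cons (b 0 * c) (Fin.tail b)) := by
  have hf0 : V.orderEmbOfFin hV 0 = 0 := by
    have h1 := Finset.orderEmbOfFin_zero hV (Nat.succ_pos m)
    have h2 : V.min' ⟨0, h0⟩ ≤ 0 := Finset.min'_le V 0 h0
    have h3 : V.orderEmbOfFin hV 0 = V.min' ⟨0, h0⟩ := h1
    rw [h3]
    exact le_antisymm h2 (Fin.zero_le _)
  have hfV : univ.map (V.orderEmbOfFin hV).toEmbedding = V :=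
    Finset.map_orderEmbOfFin_univ V hV
  generalize V.orderEmbOfFin hV = f at hf0 hfV
  have hfs : ∀ x : Fin m, ∃ y : Fin n, f x.succ = y.succ := by
    intro x
    have : f x.succ ≠ 0 := by
      rw [← hf0, Ne, f.injective.eq_iff]
      exact Fin.succ_ne_zero x
    obtain ⟨y, hy⟩ := Fin.exists_succ_eq.2 this
    exact ⟨y, hy.symm⟩
  have hpre : doublePre V = univ.map (consOrderEmb f).toEmbedding := by
    ext x
    rw [mem_doublePre, ← hfV]
    induction x using Fin.cases with
    | zero =>
      simp only [mergeZeroOne_zero, mem_map, mem_univ, true_and]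
      exact ⟨fun _ => ⟨0, rfl⟩, fun _ => ⟨0, hf0⟩⟩
    | succ x =>
      simp only [mergeZeroOne_succ, mem_map, mem_univ, true_and]
      constructor
      · rintro ⟨y, rfl⟩
        exact ⟨y.succ, rfl⟩
      · rintro ⟨y, hy⟩
        induction y using Fin.cases with
        | zero => exact absurd hy.symm (Fin.succ_ne_zero x)
        | succ y => exact ⟨y, Fin.succ_injective _ hy⟩
  have h1 : consOrderEmb f 1 = 1 := by
    have : (1 : Fin (m + 2)) = (0 : Fin (m + 1)).succ := rfl
    rw [this, consOrderEmb_succ, hf0]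
    rfl
  have := h (b ∘ f) c
  rw [hpre, cutSum_map κ _ (consOrderEmb_zero f) h1]
  conv_rhs => rw [← hfV, blockCum_map]
  convert this using 2
  · funext x
    induction x using Fin.cases with
    | zero => simp [hf0]
    | succ x =>
      induction x using Fin.cases with
      | zero =>
        simp only [Fin.succ_zero_eq_one, Function.comp_apply, h1]
        rfl
      | succ x =>
        obtain ⟨y, hy⟩ := hfs x
        simp [Fin.tail, hy]
  · funext x
    induction x using Fin.cases with
    | zero => simp [hf0]
    | succ x =>
      obtain ⟨y, hy⟩ := hfs x
      simp [Fin.tail, hy]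

theorem NCset_eq_NCeps {n : ℕ} :
    NCset n = NCeps (fun _ _ : Unit => false) (fun _ : Fin n => ()) := by
  ext P
  constructor
  · rintro ⟨h, h'⟩
    exact ⟨h, fun _ _ _ => rfl, fun p₁ q₁ p₂ q₂ h₁ h₂ h₃ hp hq hn =>
      absurd (h' p₁ q₁ p₂ q₂ h₁ h₂ h₃ hp hq) hn⟩
  · rintro ⟨h, -, h'⟩
    refine ⟨h, fun p₁ q₁ p₂ q₂ h₁ h₂ h₃ hp hq => ?_⟩
    by_contra hn
    exact Bool.false_ne_true (h' p₁ q₁ p₂ q₂ h₁ h₂ h₃ hp hq hn)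

theorem isPartition_singleton_univ : IsPartition ({univ} : Finset (Finset (Fin (n + 1)))) := by
  refine ⟨?_, fun k => ⟨univ, by simp, by simp⟩⟩
  rw [mem_singleton]
  exact fun h => Finset.univ_nonempty.ne_empty h.symm

theorem singleton_univ_mem_NCset : ({univ} : Finset (Finset (Fin (n + 1)))) ∈ NCset (n + 1) :=
  ⟨isPartition_singleton_univ, fun _ _ _ _ _ _ _ _ _ => ⟨univ, by simp, by simp, by simp⟩⟩

theorem IsPartition.eq_singleton_univ {σ : Finset (Finset (Fin (n + 1)))} (hσ : IsPartition σ)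
    (h : blockOf σ 0 = univ) : σ = {univ} := by
  refine hσ.ext isPartition_singleton_univ fun x y => ?_
  have hz : ∀ z, SameBlock σ 0 z := fun z => mem_blockOf.1 (h ▸ mem_univ z)
  exact ⟨fun _ => ⟨univ, by simp, by simp, by simp⟩,
    fun _ => hσ.sameBlock_trans (hz x).symm (hz y)⟩

/-- The free cumulants with a product as first argument. -/
theorem cutSum_univ_eq [Ring A] [Algebra ℂ A] {φ : A →ₗ[ℂ] ℂ} (hκ : IsFreeCumulants φ κ)
    (m : ℕ) (b : Fin (m + 1) → A) (c : A) :
    cutSum κ (univ : Finset (Fin (m + 2))) (Fin.cons (b 0) (Fin.cons c (Fin.tail b))) =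
      blockCum κ univ (Fin.cons (b 0 * c) (Fin.tail b) : Fin (m + 1) → A) := by
  classical
  induction m using Nat.strong_induction_on generalizing c with
  | _ m ih =>
    have hprod : (List.ofFn (Fin.cons (b 0) (Fin.cons c (Fin.tail b)) : Fin (m + 2) → A)).prod =
        (List.ofFn (Fin.cons (b 0 * c) (Fin.tail b) : Fin (m + 1) → A)).prod := by
      simp [List.ofFn_succ, mul_assoc]
    have hidx : (fun _ : Fin (m + 2) => ()) =
        Fin.cons ((fun _ : Fin (m + 1) => ()) 0) (fun _ : Fin (m + 1) => ()) := rfl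
    have hmoment := congrArg φ hprod
    rw [hκ, hκ, NCset_eq_NCeps, NCset_eq_NCeps, hidx] at hmoment
    have hsum := (finsum_NCeps_double κ (ε := fun _ _ : Unit => false) (fun _ _ => rfl)
      (fun _ => rfl) (fun _ => ()) b c).symm.trans
      (hmoment.trans (finsum_NCeps_mul κ _ _))
    rw [← NCset_eq_NCeps, finsum_mem_eq_toFinset_sum, finsum_mem_eq_toFinset_sum, ← sub_eq_zero,
      ← Finset.sum_sub_distrib, Finset.sum_eq_single ({univ} : Finset (Finset (Fin (m + 1))))]
      at hsum
    · have hB : blockOf ({univ} : Finset (Finset (Fin (m + 1)))) 0 = univ := by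
        ext x
        simp [mem_blockOf, SameBlock]
      have hU : doublePre (univ : Finset (Fin (m + 1))) = univ := by
        ext x
        simp [mem_doublePre]
      rw [hB, hU] at hsum
      simp only [Finset.erase_singleton, Finset.prod_empty, mul_one] at hsum
      exact sub_eq_zero.1 hsum
    · intro σ hσ hne
      have hpart : IsPartition σ := (Set.mem_toFinset.1 hσ).1
      have h0 : (0 : Fin (m + 1)) ∈ blockOf σ 0 := mem_blockOf.2 (hpart.sameBlock_refl 0)
      have hlt : (blockOf σ 0).card < m + 1 := by
        by_contra hge
        refine hne (hpart.eq_singleton_univ (Finset.eq_univ_of_card _ ?_))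
        have := Finset.card_le_univ (blockOf σ 0)
        simp only [Fintype.card_fin] at this ⊢
        omega
      obtain ⟨k, hk⟩ := Nat.exists_eq_succ_of_ne_zero (Finset.card_pos.2 ⟨0, h0⟩).ne'
      rw [cutSum_doublePre_of_card κ (ih k (by omega)) h0 hk, sub_self]
    · intro h
      exact absurd (Set.mem_toFinset.2 singleton_univ_mem_NCset) h

end Cumulants

/-- For arbitrary elements `b₁, b̃₁, b₂, …, bₙ` of `A` (here
`b : Fin (n+1) → A` is the tuple `(b₁, …, bₙ)` with `n + 1` entries and `btilde` is
`b̃₁`), the sum of the free-cumulant terms `κ_π(b₁, b̃₁, b₂, …, bₙ)` over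
`π ∈ NC^ε[(i(1), i(1), i(2), …, i(n))]` equals the sum of the terms
`κ_σ(b₁ b̃₁, b₂, …, bₙ)` over `σ ∈ NC^ε[(i(1), i(2), …, i(n))]`. -/
theorem NCeps_cumulant_sum_doubling {I : Type*} {A : Type*} [Ring A] [Algebra ℂ A]
    (ε : I → I → Bool) (hsym : ∀ i j, ε i j = ε j i) (hdiag : ∀ i, ε i i = false)
    (φ : A →ₗ[ℂ] ℂ) (hφ1 : φ 1 = 1)
    (κ : (m : ℕ) → (Fin m → A) → ℂ) (hκ : IsFreeCumulants φ κ)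
    (n : ℕ) (idx : Fin (n + 1) → I) (b : Fin (n + 1) → A) (btilde : A) :
    (∑ᶠ P ∈ NCeps ε (Fin.cons (idx 0) idx),
        cumPart κ P (Fin.cons (b 0) (Fin.cons btilde (Fin.tail b)))) =
    ∑ᶠ P ∈ NCeps ε idx, cumPart κ P (Fin.cons (b 0 * btilde) (Fin.tail b)) := by
  rw [finsum_NCeps_double κ hsym hdiag, finsum_NCeps_mul]
  refine finsum_mem_congr rfl fun σ hσ => ?_
  have h0 : (0 : Fin (n + 1)) ∈ blockOf σ 0 := mem_blockOf.2 (hσ.1.sameBlock_refl 0)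
  obtain ⟨k, hk⟩ := Nat.exists_eq_succ_of_ne_zero (Finset.card_pos.2 ⟨0, h0⟩).ne'
  rw [cutSum_doublePre_of_card κ (cutSum_univ_eq κ hκ k) h0 hk]
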